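/- Fix 0 < α < 1 and a ≥ 2^α(2+α)/(1−α). The map T_α admits a unique absolutely continuous invariant probability measure, and its density lies in the cone C₂; in particular the density h satisfies P_α h = h, h ≥ 0, ∫₀¹ h dm = 1, and h(x) ≤ a x^{−α} for all x ∈ (0,1]. -/

import Mathlib

open MeasureTheory Set

/-- The Pomeau–Manneville type map `T_β` on `[0,1]` (identified with the circle `S¹`):
`T_β x = x + 3^β/2^(1+β) x^(1+β)` for `x ≤ 2/3` and `T_β x = 3x - 2` otherwise. -/
noncomputable def Tmap (β x : ℝ) : ℝ :=
  if x ≤ 2/3 then x + (3:ℝ)^β / 2^(1+β) * x^(1+β) else 3*x - 2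

/-- The derivative of `T_β` (left-branch formula at `x ≤ 2/3`). -/
noncomputable def Tderiv (β x : ℝ) : ℝ :=
  if x ≤ 2/3 then 1 + (3:ℝ)^β / 2^(1+β) * (1+β) * x^β else 3

/-- The second derivative of `T_β`. -/
noncomputable def Tderiv2 (β x : ℝ) : ℝ :=
  if x ≤ 2/3 then (3:ℝ)^β / 2^(1+β) * (1+β) * β * x^(β-1) else 0

/-- The inverse of the left branch of `T_β` (for `x ∈ [0,1]` this is the unique
`y ∈ [0,2/3]` with `T_β y = x`). -/
noncomputable def leftInv (β x : ℝ) : ℝ :=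
  sSup {y : ℝ | y ∈ Set.Icc (0:ℝ) (2/3) ∧ Tmap β y ≤ x}

/-- The Perron–Frobenius transfer operator of `T_β` with respect to Lebesgue measure:
`P_β f (x) = ∑_{y ∈ T_β⁻¹ x} f y / T_β' y`; the right branch preimage of `x` is `(x+2)/3`,
where the derivative is `3`. -/
noncomputable def Pop (β : ℝ) (f : ℝ → ℝ) (x : ℝ) : ℝ :=
  f (leftInv β x) / Tderiv β (leftInv β x) + f ((x+2)/3) / 3

/-- `P_{β_{k+n}} ∘ ⋯ ∘ P_{β_{k+1}}`. -/
noncomputable def PopCompFrom (β : ℕ → ℝ) (k : ℕ) : ℕ → (ℝ → ℝ) → ℝ → ℝ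
  | 0, f => f
  | n+1, f => Pop (β (k+n+1)) (PopCompFrom β k n f)

/-- `P_{β_n} ∘ ⋯ ∘ P_{β_1}`. -/
noncomputable def PopComp (β : ℕ → ℝ) (n : ℕ) : (ℝ → ℝ) → ℝ → ℝ :=
  PopCompFrom β 0 n

/-- `T_{β_{k+n}} ∘ ⋯ ∘ T_{β_{k+1}}`. -/
noncomputable def TcompFrom (β : ℕ → ℝ) (k : ℕ) : ℕ → ℝ → ℝ
  | 0, x => x
  | n+1, x => Tmap (β (k+n+1)) (TcompFrom β k n x)

/-- The derivative `(T_{β_{k+n}} ∘ ⋯ ∘ T_{β_{k+1}})'(z)`, computed as the product of the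
derivatives along the orbit of `z`. -/
noncomputable def DcompFrom (β : ℕ → ℝ) (k n : ℕ) (z : ℝ) : ℝ :=
  ∏ i ∈ Finset.range n, Tderiv (β (k+i+1)) (TcompFrom β k i z)

/-- The averaging operator `A_ε f (x) = (1/(2ε)) ∫_{B_ε(x)} f dm` on the circle,
realized via the 1-periodic extension of `f`. -/
noncomputable def Aop (ε : ℝ) (f : ℝ → ℝ) (x : ℝ) : ℝ :=
  (1/(2*ε)) * ∫ t in (x-ε)..(x+ε), f (Int.fract t)

/-- The indicator function of the ball `B_ε(z)` of radius `ε` around `z` in the circle `ℝ/ℤ`. -/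
noncomputable def ballInd (ε z : ℝ) : ℝ → ℝ :=
  Set.indicator {y : ℝ | ∃ k : ℤ, |y - z - (k:ℝ)| < ε} (fun _ => 1)

/-- The cone `C₁ = {f ∈ C⁰((0,1]) : f ≥ 0, f decreasing, x ↦ x^(α+1) f x increasing}`. -/
def memC1 (α : ℝ) (f : ℝ → ℝ) : Prop :=
  ContinuousOn f (Set.Ioc 0 1) ∧ (∀ x ∈ Set.Ioc (0:ℝ) 1, 0 ≤ f x) ∧
  AntitoneOn f (Set.Ioc 0 1) ∧ MonotoneOn (fun x : ℝ => x^(α+1) * f x) (Set.Ioc 0 1)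

/-- `m(f) = ∫₀¹ f dm` (Lebesgue). -/
noncomputable def mInt (f : ℝ → ℝ) : ℝ := ∫ x in Set.Ioc (0:ℝ) 1, f x

/-- The cone `C₂ = {f ∈ C₁ ∩ L¹(m) : f x ≤ a x^(-α) m(f)}`. -/
def memC2 (α a : ℝ) (f : ℝ → ℝ) : Prop :=
  memC1 α f ∧ IntegrableOn f (Set.Ioc 0 1) volume ∧
  ∀ x ∈ Set.Ioc (0:ℝ) 1, f x ≤ a * x^(-α) * mInt f

/-- The `L¹(m)` norm on `[0,1]`. -/
noncomputable def L1norm (f : ℝ → ℝ) : ℝ := ∫ x in Set.Ioc (0:ℝ) 1, |f x|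

/-- The `C¹` norm `‖f‖_∞ + ‖f'‖_∞` on the circle. -/
noncomputable def C1norm (f : ℝ → ℝ) : ℝ :=
  (⨆ x : Set.Icc (0:ℝ) 1, |f (x:ℝ)|) + ⨆ x : Set.Icc (0:ℝ) 1, |deriv f (x:ℝ)|

open Filter Topology

/-- The coefficient of `x ^ (1 + α)` in the left branch of `Tmap α`. -/
noncomputable def leftCoeff (α : ℝ) : ℝ := (3:ℝ)^α / 2^(1+α)

lemma leftCoeff_pos (α : ℝ) : 0 < leftCoeff α := by unfold leftCoeff; positivity

lemma half_le_leftCoeff {α : ℝ} (hα0 : 0 < α) : 1/2 ≤ leftCoeff α := by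
  have h : (2:ℝ)^α ≤ 3^α := Real.rpow_le_rpow (by norm_num) (by norm_num) hα0.le
  have h2 : (0:ℝ) < 2^α := by positivity
  rw [leftCoeff, Real.rpow_add (by norm_num), Real.rpow_one, div_le_div_iff₀ (by norm_num)
    (by positivity)]
  linarith

lemma leftCoeff_mul_two_thirds (α : ℝ) : leftCoeff α * (2/3:ℝ)^α = 1/2 := by
  have h2 : (0:ℝ) < 2^α := by positivity
  have h3 : (0:ℝ) < 3^α := by positivity
  rw [leftCoeff, Real.rpow_add (by norm_num), Real.rpow_one, Real.div_rpow (by norm_num)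
    (by norm_num)]
  field_simp

lemma leftCoeff_mul_rpow_le {α y : ℝ} (hα0 : 0 < α) (hy0 : 0 ≤ y) (hy : y ≤ 2/3) :
    leftCoeff α * y^α ≤ 1/2 := by
  rw [← leftCoeff_mul_two_thirds α]
  exact mul_le_mul_of_nonneg_left (Real.rpow_le_rpow hy0 hy hα0.le) (leftCoeff_pos α).le

lemma Tmap_left {α y : ℝ} (hα0 : 0 < α) (hy0 : 0 ≤ y) (hy : y ≤ 2/3) :
    Tmap α y = y * (1 + leftCoeff α * y^α) := by
  rw [Tmap, if_pos hy, Real.rpow_add_of_nonneg hy0 zero_le_one hα0.le, Real.rpow_one, leftCoeff]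
  ring

lemma Tmap_right {α y : ℝ} (hy : 2/3 < y) : Tmap α y = 3*y - 2 := by
  rw [Tmap, if_neg hy.not_ge]

lemma Tderiv_left {α y : ℝ} (hy : y ≤ 2/3) :
    Tderiv α y = 1 + (1 + α) * (leftCoeff α * y^α) := by
  rw [Tderiv, if_pos hy, leftCoeff]
  ring

lemma sub_le_Tmap_sub {α x y : ℝ} (hα0 : 0 < α) (hx : 0 ≤ x) (hxy : x ≤ y) (hy : y ≤ 2/3) :
    y - x ≤ Tmap α y - Tmap α x := by
  have h1 : x^α ≤ y^α := Real.rpow_le_rpow hx hxy hα0.le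
  have h2 := leftCoeff_pos α
  have h3 : x * x^α ≤ y * y^α := mul_le_mul hxy h1 (by positivity) (by linarith)
  rw [Tmap_left hα0 (hx.trans hxy) hy, Tmap_left hα0 hx (hxy.trans hy)]
  nlinarith

lemma Tmap_zero {α : ℝ} (hα0 : 0 < α) : Tmap α 0 = 0 := by
  rw [Tmap_left hα0 le_rfl (by norm_num), zero_mul]

lemma Tmap_two_thirds {α : ℝ} (hα0 : 0 < α) : Tmap α (2/3) = 1 := by
  rw [Tmap_left hα0 (by norm_num) le_rfl, leftCoeff_mul_two_thirds]
  norm_num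

lemma strictMonoOn_Tmap_left {α : ℝ} (hα0 : 0 < α) : StrictMonoOn (Tmap α) (Icc 0 (2/3)) := by
  intro x hx y hy hxy
  have := sub_le_Tmap_sub hα0 hx.1 hxy.le hy.2
  linarith

lemma leftInv_Tmap {α y : ℝ} (hα0 : 0 < α) (hy : y ∈ Icc (0:ℝ) (2/3)) :
    leftInv α (Tmap α y) = y := by
  have : {z : ℝ | z ∈ Icc (0:ℝ) (2/3) ∧ Tmap α z ≤ Tmap α y} = Icc 0 y := by
    ext z
    constructor
    · rintro ⟨hz, h⟩
      exact ⟨hz.1, ((strictMonoOn_Tmap_left hα0).le_iff_le hz hy).1 h⟩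
    · rintro hz
      have hz' : z ∈ Icc (0:ℝ) (2/3) := ⟨hz.1, hz.2.trans hy.2⟩
      exact ⟨hz', ((strictMonoOn_Tmap_left hα0).le_iff_le hz' hy).2 hz.2⟩
  rw [leftInv, this, csSup_Icc hy.1]

lemma continuousOn_Tmap_left {α : ℝ} (hα0 : 0 < α) : ContinuousOn (Tmap α) (Icc 0 (2/3)) := by
  have h : ContinuousOn (fun y : ℝ => y * (1 + leftCoeff α * y^α)) (Icc 0 (2/3)) :=
    (continuous_id.mul (continuous_const.add
      (continuous_const.mul (Real.continuous_rpow_const hα0.le)))).continuousOn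
  exact h.congr fun y hy => Tmap_left hα0 hy.1 hy.2

lemma exists_Tmap_left_eq_of_mem_Icc {α x : ℝ} (hα0 : 0 < α) (hx : x ∈ Icc (0:ℝ) 1) :
    ∃ y ∈ Icc (0:ℝ) (2/3), Tmap α y = x := by
  have h := intermediate_value_Icc (by norm_num : (0:ℝ) ≤ 2/3) (continuousOn_Tmap_left hα0)
  rw [Tmap_zero hα0, Tmap_two_thirds hα0] at h
  exact h hx

lemma Tmap_left_mem_Ioc {α y : ℝ} (hα0 : 0 < α) (hy : y ∈ Ioc (0:ℝ) (2/3)) :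
    Tmap α y ∈ Ioc (0:ℝ) 1 := by
  have h1 := sub_le_Tmap_sub hα0 le_rfl hy.1.le hy.2
  have h2 := sub_le_Tmap_sub hα0 hy.1.le hy.2 le_rfl
  rw [Tmap_zero hα0] at h1
  rw [Tmap_two_thirds hα0] at h2
  constructor <;> linarith [hy.1, hy.2]

lemma exists_Tmap_left_eq {α x : ℝ} (hα0 : 0 < α) (hx : x ∈ Ioc (0:ℝ) 1) :
    ∃ y ∈ Ioc (0:ℝ) (2/3), Tmap α y = x := by
  obtain ⟨y, hy, rfl⟩ := exists_Tmap_left_eq_of_mem_Icc hα0 ⟨hx.1.le, hx.2⟩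
  refine ⟨y, ⟨lt_of_le_of_ne hy.1 ?_, hy.2⟩, rfl⟩
  rintro rfl
  rw [Tmap_zero hα0] at hx
  exact lt_irrefl _ hx.1

lemma image_Tmap_left {α : ℝ} (hα0 : 0 < α) : Tmap α '' Ioc 0 (2/3) = Ioc 0 1 := by
  ext x
  constructor
  · rintro ⟨y, hy, rfl⟩
    exact Tmap_left_mem_Ioc hα0 hy
  · intro hx
    obtain ⟨y, hy, h⟩ := exists_Tmap_left_eq hα0 hx
    exact ⟨y, hy, h⟩

lemma Tmap_right_mem_Ioc {α y : ℝ} (hy : y ∈ Ioc (2/3:ℝ) 1) : Tmap α y ∈ Ioc (0:ℝ) 1 := by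
  rw [Tmap_right hy.1]
  constructor <;> linarith [hy.1, hy.2]

lemma image_Tmap_right (α : ℝ) : Tmap α '' Ioc (2/3) 1 = Ioc 0 1 := by
  ext x
  constructor
  · rintro ⟨y, hy, rfl⟩
    exact Tmap_right_mem_Ioc hy
  · intro hx
    have h : 2/3 < (x+2)/3 := by linarith [hx.1]
    refine ⟨(x+2)/3, ⟨h, by linarith [hx.2]⟩, ?_⟩
    rw [Tmap_right h]
    ring

lemma measurable_Tmap (α : ℝ) : Measurable (Tmap α) := by
  unfold Tmap
  refine Measurable.ite measurableSet_Iic ?_ (by fun_prop)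
  fun_prop

lemma hasDerivWithinAt_Tmap_left {α y : ℝ} (hy : y ∈ Ioc (0:ℝ) (2/3)) :
    HasDerivWithinAt (Tmap α) (Tderiv α y) (Ioc 0 (2/3)) y := by
  have h : HasDerivAt (fun x : ℝ => x + (3:ℝ)^α / 2^(1+α) * x^(1+α))
      (1 + (3:ℝ)^α / 2^(1+α) * ((1+α) * y^(1+α-1))) y :=
    (hasDerivAt_id y).add ((Real.hasDerivAt_rpow_const (Or.inl hy.1.ne')).const_mul _)
  have he : Tderiv α y = 1 + (3:ℝ)^α / 2^(1+α) * ((1+α) * y^(1+α-1)) := by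
    rw [Tderiv, if_pos hy.2, add_sub_cancel_left]
    ring
  rw [he]
  refine h.hasDerivWithinAt.congr (fun x hx => ?_) ?_ <;> rw [Tmap, if_pos]
  exacts [hx.2, hy.2]

lemma hasDerivWithinAt_Tmap_right {α y : ℝ} (hy : y ∈ Ioc (2/3:ℝ) 1) :
    HasDerivWithinAt (Tmap α) 3 (Ioc (2/3) 1) y := by
  have h : HasDerivAt (fun x : ℝ => 3*x - 2) 3 y := by
    simpa using ((hasDerivAt_id y).const_mul 3).sub_const 2
  exact h.hasDerivWithinAt.congr (fun x hx => Tmap_right hx.1) (Tmap_right hy.1)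

/-- The contribution of the left branch to the transfer operator. -/
noncomputable def leftOp (α : ℝ) (f : ℝ → ℝ) (x : ℝ) : ℝ :=
  f (leftInv α x) / Tderiv α (leftInv α x)

/-- The contribution of the right branch to the transfer operator. -/
noncomputable def rightOp (f : ℝ → ℝ) (x : ℝ) : ℝ := f ((x+2)/3) / 3

lemma Pop_eq_add (α : ℝ) (f : ℝ → ℝ) (x : ℝ) : Pop α f x = leftOp α f x + rightOp f x := rfl

lemma leftOp_Tmap {α y : ℝ} (hα0 : 0 < α) (f : ℝ → ℝ) (hy : y ∈ Ioc (0:ℝ) (2/3)) :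
    leftOp α f (Tmap α y) = f y / Tderiv α y := by
  rw [leftOp, leftInv_Tmap hα0 ⟨hy.1.le, hy.2⟩]

lemma one_le_Tderiv_left {α y : ℝ} (hα0 : 0 < α) (hy : y ∈ Ioc (0:ℝ) (2/3)) :
    1 ≤ Tderiv α y := by
  have := leftCoeff_pos α
  have := hy.1
  rw [Tderiv_left hy.2, le_add_iff_nonneg_right]
  positivity

lemma setLIntegral_leftOp {α : ℝ} (hα0 : 0 < α) (f : ℝ → ℝ) {B : Set ℝ} (hB : MeasurableSet B) :
    ∫⁻ x in B ∩ Ioc 0 1, ENNReal.ofReal (leftOp α f x)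
      = ∫⁻ y in Tmap α ⁻¹' B ∩ Ioc 0 (2/3), ENNReal.ofReal (f y) := by
  have himg : B ∩ Ioc 0 1 = Tmap α '' (Tmap α ⁻¹' B ∩ Ioc 0 (2/3)) := by
    rw [← image_Tmap_left hα0, image_preimage_inter]
  have hs : MeasurableSet (Tmap α ⁻¹' B ∩ Ioc 0 (2/3)) :=
    (measurable_Tmap α hB).inter measurableSet_Ioc
  have hinj : InjOn (Tmap α) (Tmap α ⁻¹' B ∩ Ioc 0 (2/3)) :=
    (strictMonoOn_Tmap_left hα0).injOn.mono fun y hy => Ioc_subset_Icc_self hy.2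
  rw [himg, lintegral_image_eq_lintegral_abs_deriv_mul hs
    (fun y hy => (hasDerivWithinAt_Tmap_left hy.2).mono inter_subset_right)
    hinj]
  refine setLIntegral_congr_fun hs fun y hy => ?_
  have h := one_le_Tderiv_left hα0 hy.2
  rw [leftOp_Tmap hα0 f hy.2, ← ENNReal.ofReal_mul (abs_nonneg _), abs_of_nonneg (by linarith),
    mul_div_cancel₀ _ (by linarith)]

lemma setLIntegral_rightOp (α : ℝ) (f : ℝ → ℝ) {B : Set ℝ} (hB : MeasurableSet B) :
    ∫⁻ x in B ∩ Ioc 0 1, ENNReal.ofReal (rightOp f x)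
      = ∫⁻ y in Tmap α ⁻¹' B ∩ Ioc (2/3) 1, ENNReal.ofReal (f y) := by
  have himg : B ∩ Ioc 0 1 = Tmap α '' (Tmap α ⁻¹' B ∩ Ioc (2/3) 1) := by
    rw [← image_Tmap_right α, image_preimage_inter]
  have hs : MeasurableSet (Tmap α ⁻¹' B ∩ Ioc (2/3) 1) :=
    (measurable_Tmap α hB).inter measurableSet_Ioc
  have hinj : InjOn (Tmap α) (Tmap α ⁻¹' B ∩ Ioc (2/3) 1) := by
    intro x hx y hy h
    rw [Tmap_right hx.2.1, Tmap_right hy.2.1] at h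
    linarith
  rw [himg, lintegral_image_eq_lintegral_abs_deriv_mul hs
    (fun y hy => (hasDerivWithinAt_Tmap_right hy.2).mono inter_subset_right) hinj]
  refine setLIntegral_congr_fun hs fun y hy => ?_
  rw [rightOp, Tmap_right hy.2.1, ← ENNReal.ofReal_mul (abs_nonneg _)]
  congr 1
  norm_num
  ring

/-- Two-sided comparison of the values of a function in the cone `C₁`. -/
lemma memC1.rpow_div_mul_le {α : ℝ} {f : ℝ → ℝ} (hf : memC1 α f) {x y : ℝ} (hx : x ∈ Ioc (0:ℝ) 1)
    (hy : y ∈ Ioc (0:ℝ) 1) (hxy : x ≤ y) : (x/y)^(α+1) * f x ≤ f y := by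
  have h := hf.2.2.2 hx hy hxy
  have hy0 : 0 < y^(α+1) := Real.rpow_pos_of_pos hy.1 _
  rw [Real.div_rpow hx.1.le hy.1.le, div_mul_eq_mul_div, div_le_iff₀ hy0, mul_comm (f y)]
  exact h

lemma memC1_of_monotone {α : ℝ} {f : ℝ → ℝ} (h0 : ∀ x ∈ Ioc (0:ℝ) 1, 0 ≤ f x)
    (hanti : AntitoneOn f (Ioc 0 1)) (hmono : MonotoneOn (fun x : ℝ => x^(α+1) * f x) (Ioc 0 1)) :
    memC1 α f := by
  refine ⟨fun x hx => ?_, h0, hanti, hmono⟩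
  have hr : ContinuousAt (fun y : ℝ => (x/y)^(α+1)) x :=
    (continuousAt_const.div continuousAt_id hx.1.ne').rpow_const
      (Or.inl (div_pos hx.1 hx.1).ne')
  have hr1 : Tendsto (fun y : ℝ => (x/y)^(α+1) * f x) (𝓝[Ioc 0 1] x) (𝓝 (f x)) := by
    have := (hr.tendsto.mono_left (nhdsWithin_le_nhds (s := Ioc 0 1))).mul_const (f x)
    simpa [div_self hx.1.ne'] using this
  have key : ∀ y ∈ Ioc (0:ℝ) 1, (x/y)^(α+1) * f x = x^(α+1) * f x / y^(α+1) := fun y hy => by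
    rw [Real.div_rpow hx.1.le hy.1.le]; ring
  have hlow : Tendsto (fun y : ℝ => min ((x/y)^(α+1) * f x) (f x)) (𝓝[Ioc 0 1] x) (𝓝 (f x)) := by
    simpa using hr1.min (tendsto_const_nhds (x := f x))
  have hup : Tendsto (fun y : ℝ => max ((x/y)^(α+1) * f x) (f x)) (𝓝[Ioc 0 1] x) (𝓝 (f x)) := by
    simpa using hr1.max (tendsto_const_nhds (x := f x))
  refine tendsto_of_tendsto_of_tendsto_of_le_of_le' hlow hup ?_ ?_ <;>
    filter_upwards [self_mem_nhdsWithin] with y hy <;>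
    have hy0 : 0 < y^(α+1) := Real.rpow_pos_of_pos hy.1 _ <;>
    rw [key y hy]
  · rcases le_total x y with h | h
    · refine min_le_of_left_le ?_
      rw [div_le_iff₀ hy0, mul_comm (f y)]
      exact hmono hx hy h
    · exact min_le_of_right_le (hanti hy hx h)
  · rcases le_total x y with h | h
    · exact le_max_of_le_right (hanti hx hy h)
    · refine le_max_of_le_left ?_
      rw [le_div_iff₀ hy0, mul_comm (f y)]
      exact hmono hy hx h

lemma rpow_one_add_mul_le {α s t : ℝ} (hα0 : 0 < α) (hs : 0 ≤ s) (hst : s ≤ t) :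
    (1+s)^(α+1) * (1+(1+α)*t) ≤ (1+t)^(α+1) * (1+(1+α)*s) := by
  have hs1 : 0 < 1 + s := by linarith
  have hu : 0 ≤ (t-s)/(1+s) := div_nonneg (by linarith) hs1.le
  have hb := one_add_mul_self_le_rpow_one_add (by linarith : -1 ≤ (t-s)/(1+s))
    (by linarith : 1 ≤ α+1)
  have he : 1 + t = (1+s) * (1 + (t-s)/(1+s)) := by field_simp; ring
  have hP : 0 ≤ (1+s)^(α+1) := by positivity
  rw [he, Real.mul_rpow hs1.le (by linarith), mul_assoc]
  refine mul_le_mul_of_nonneg_left ?_ hP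
  have h2 : (1+(1+α)*t) ≤ (1+(α+1)*((t-s)/(1+s))) * (1+(1+α)*s) := by
    have hd : t = s + (1+s) * ((t-s)/(1+s)) := by field_simp; ring
    set u := (t-s)/(1+s)
    rw [hd]
    nlinarith [mul_nonneg (mul_nonneg hα0.le hs) hu, mul_nonneg hα0.le hu,
      mul_nonneg (mul_nonneg (mul_nonneg hα0.le hα0.le) hs) hu]
  exact h2.trans (mul_le_mul_of_nonneg_right hb (by positivity))

lemma memC1.map_leftOp {α : ℝ} {f : ℝ → ℝ} (hα0 : 0 < α) (hf : memC1 α f) :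
    memC1 α (leftOp α f) := by
  have hsub : ∀ y ∈ Ioc (0:ℝ) (2/3), y ∈ Ioc (0:ℝ) 1 := fun y hy =>
    ⟨hy.1, hy.2.trans (by norm_num)⟩
  have hle : ∀ {y y' : ℝ}, y ∈ Ioc (0:ℝ) (2/3) → y' ∈ Ioc (0:ℝ) (2/3) →
      Tmap α y ≤ Tmap α y' → y ≤ y' := fun hy hy' h =>
    ((strictMonoOn_Tmap_left hα0).le_iff_le (Ioc_subset_Icc_self hy)
      (Ioc_subset_Icc_self hy')).1 h
  refine memC1_of_monotone ?_ ?_ ?_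
  · intro x hx
    obtain ⟨y, hy, rfl⟩ := exists_Tmap_left_eq hα0 hx
    rw [leftOp_Tmap hα0 f hy]
    exact div_nonneg (hf.2.1 y (hsub y hy)) (zero_le_one.trans (one_le_Tderiv_left hα0 hy))
  · intro x hx x' hx' hxx
    obtain ⟨y, hy, rfl⟩ := exists_Tmap_left_eq hα0 hx
    obtain ⟨y', hy', rfl⟩ := exists_Tmap_left_eq hα0 hx'
    have hyy := hle hy hy' hxx
    rw [leftOp_Tmap hα0 f hy, leftOp_Tmap hα0 f hy']
    refine div_le_div₀ (hf.2.1 y (hsub y hy)) (hf.2.2.1 (hsub y hy) (hsub y' hy') hyy)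
      (zero_lt_one.trans_le (one_le_Tderiv_left hα0 hy)) ?_
    rw [Tderiv_left hy.2, Tderiv_left hy'.2]
    have := Real.rpow_le_rpow hy.1.le hyy hα0.le
    have := leftCoeff_pos α
    gcongr
  · intro x hx x' hx' hxx
    obtain ⟨y, hy, rfl⟩ := exists_Tmap_left_eq hα0 hx
    obtain ⟨y', hy', rfl⟩ := exists_Tmap_left_eq hα0 hx'
    have hyy := hle hy hy' hxx
    have hc := leftCoeff_pos α
    have hs0 : 0 ≤ leftCoeff α * y^α := mul_nonneg hc.le (Real.rpow_nonneg hy.1.le _)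
    have hss : leftCoeff α * y^α ≤ leftCoeff α * y'^α :=
      mul_le_mul_of_nonneg_left (Real.rpow_le_rpow hy.1.le hyy hα0.le) hc.le
    have hr := rpow_one_add_mul_le hα0 hs0 hss
    simp only [leftOp_Tmap hα0 f hy, leftOp_Tmap hα0 f hy']
    rw [Tderiv_left hy.2, Tderiv_left hy'.2, Tmap_left hα0 hy.1.le hy.2,
      Tmap_left hα0 hy'.1.le hy'.2]
    generalize leftCoeff α * y^α = s at *
    generalize leftCoeff α * y'^α = t at *
    have hm : y^(α+1) * f y ≤ y'^(α+1) * f y' := hf.2.2.2 (hsub y hy) (hsub y' hy') hyy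
    have hn : 0 ≤ y'^(α+1) * f y' :=
      mul_nonneg (Real.rpow_nonneg hy'.1.le _) (hf.2.1 y' (hsub y' hy'))
    have hds : 0 < 1 + (1+α)*s := by positivity
    have ht0 : 0 ≤ t := hs0.trans hss
    have hdt : 0 < 1 + (1+α)*t := by positivity
    rw [Real.mul_rpow hy.1.le (by linarith), Real.mul_rpow hy'.1.le (by linarith)]
    calc y^(α+1) * (1+s)^(α+1) * (f y / (1+(1+α)*s))
        = (y^(α+1) * f y) * ((1+s)^(α+1) / (1+(1+α)*s)) := by ring
      _ ≤ (y'^(α+1) * f y') * ((1+t)^(α+1) / (1+(1+α)*t)) := by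
          refine mul_le_mul hm ?_ (by positivity) hn
          rw [div_le_div_iff₀ hds hdt]
          exact hr
      _ = _ := by ring

lemma right_preimage_mem {x : ℝ} (hx : x ∈ Ioc (0:ℝ) 1) : (x+2)/3 ∈ Ioc (2/3:ℝ) 1 := by
  constructor <;> linarith [hx.1, hx.2]

lemma Ioc_two_thirds_subset : Ioc (2/3:ℝ) 1 ⊆ Ioc 0 1 := Ioc_subset_Ioc_left (by norm_num)

lemma memC1.map_rightOp {α : ℝ} {f : ℝ → ℝ} (hα0 : 0 < α) (hf : memC1 α f) :
    memC1 α (rightOp f) := by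
  have hz : ∀ x ∈ Ioc (0:ℝ) 1, (x+2)/3 ∈ Ioc (0:ℝ) 1 := fun x hx =>
    Ioc_two_thirds_subset (right_preimage_mem hx)
  refine memC1_of_monotone ?_ ?_ ?_
  · intro x hx
    exact div_nonneg (hf.2.1 _ (hz x hx)) (by norm_num)
  · intro x hx x' hx' hxx
    exact div_le_div_of_nonneg_right (hf.2.2.1 (hz x hx) (hz x' hx') (by linarith)) (by norm_num)
  · intro x hx x' hx' hxx
    have hm := hf.2.2.2 (hz x hx) (hz x' hx') (by linarith)
    have hp := (hz x hx).1
    have hp' := (hz x' hx').1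
    have hx0 := hx.1
    have hx0' := hx'.1
    have hratio : (x/((x+2)/3))^(α+1) ≤ (x'/((x'+2)/3))^(α+1) := by
      refine Real.rpow_le_rpow (by positivity) ?_ (by linarith)
      rw [div_le_div_iff₀ hp hp']
      nlinarith
    have hsplit : ∀ u v : ℝ, 0 < u → 0 < v → u^(α+1) = (u/v)^(α+1) * v^(α+1) :=
      fun u v hu hv => by
        rw [← Real.mul_rpow (div_pos hu hv).le hv.le, div_mul_cancel₀ _ hv.ne']
    simp only [rightOp] at hm ⊢
    rw [hsplit x _ hx0 hp, hsplit x' _ hx0' hp']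
    have := mul_le_mul hratio hm (mul_nonneg (by positivity) (hf.2.1 _ (hz x hx))) (by positivity)
    linarith

lemma memC1.add {α : ℝ} {f g : ℝ → ℝ} (hf : memC1 α f) (hg : memC1 α g) :
    memC1 α (fun x => f x + g x) := by
  refine ⟨hf.1.add hg.1, fun x hx => add_nonneg (hf.2.1 x hx) (hg.2.1 x hx),
    hf.2.2.1.add hg.2.2.1, ?_⟩
  simpa only [mul_add] using hf.2.2.2.add hg.2.2.2

lemma memC1.const_mul {α c : ℝ} {f : ℝ → ℝ} (hc : 0 ≤ c) (hf : memC1 α f) :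
    memC1 α (fun x => c * f x) := by
  refine memC1_of_monotone (fun x hx => mul_nonneg hc (hf.2.1 x hx))
    (fun x hx y hy h => mul_le_mul_of_nonneg_left (hf.2.2.1 hx hy h) hc) fun x hx y hy h => ?_
  have := mul_le_mul_of_nonneg_left (hf.2.2.2 hx hy h) hc
  beta_reduce at this ⊢
  linarith

lemma memC1_one {α : ℝ} (hα0 : 0 < α) : memC1 α (fun _ => 1) := by
  refine memC1_of_monotone (fun _ _ => zero_le_one) antitoneOn_const fun x hx y hy h => ?_
  simpa using Real.rpow_le_rpow hx.1.le h (by linarith : 0 ≤ α+1)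

lemma memC1.map_Pop {α : ℝ} {f : ℝ → ℝ} (hα0 : 0 < α) (hf : memC1 α f) : memC1 α (Pop α f) :=
  (hf.map_leftOp hα0).add (hf.map_rightOp hα0)

lemma memC1.aestronglyMeasurable {α : ℝ} {f : ℝ → ℝ} (hf : memC1 α f) :
    AEStronglyMeasurable f (volume.restrict (Ioc (0:ℝ) 1)) :=
  hf.1.aestronglyMeasurable measurableSet_Ioc

lemma setLIntegral_Pop {α : ℝ} {f : ℝ → ℝ} (hα0 : 0 < α) (hf : memC1 α f) {B : Set ℝ}
    (hB : MeasurableSet B) :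
    ∫⁻ x in B ∩ Ioc 0 1, ENNReal.ofReal (Pop α f x)
      = ∫⁻ y in Tmap α ⁻¹' B ∩ Ioc 0 1, ENNReal.ofReal (f y) := by
  have hBm : MeasurableSet (B ∩ Ioc (0:ℝ) 1) := hB.inter measurableSet_Ioc
  have h1 : ∫⁻ x in B ∩ Ioc 0 1, ENNReal.ofReal (Pop α f x)
      = ∫⁻ x in B ∩ Ioc 0 1, (ENNReal.ofReal (leftOp α f x) + ENNReal.ofReal (rightOp f x)) :=
    setLIntegral_congr_fun hBm fun x hx =>
      ENNReal.ofReal_add ((hf.map_leftOp hα0).2.1 x hx.2) ((hf.map_rightOp hα0).2.1 x hx.2)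
  have hmeas : AEMeasurable (fun x => ENNReal.ofReal (leftOp α f x))
      (volume.restrict (B ∩ Ioc 0 1)) :=
    ((hf.map_leftOp hα0).aestronglyMeasurable.mono_measure
      (Measure.restrict_mono inter_subset_right le_rfl)).aemeasurable.ennreal_ofReal
  have hdisj : Disjoint (Tmap α ⁻¹' B ∩ Ioc 0 (2/3)) (Tmap α ⁻¹' B ∩ Ioc (2/3) 1) :=
    (Ioc_disjoint_Ioc_of_le le_rfl).mono inter_subset_right inter_subset_right
  rw [h1, lintegral_add_left' hmeas, setLIntegral_leftOp hα0 f hB, setLIntegral_rightOp α f hB,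
    ← lintegral_union ((measurable_Tmap α hB).inter measurableSet_Ioc) hdisj,
    ← inter_union_distrib_left, Ioc_union_Ioc_eq_Ioc (by norm_num) (by norm_num)]

/-- The functions of the cone `C₁` with integral `1` lying below `a x ^ (-α)`. -/
structure IsConeDensity (α a : ℝ) (f : ℝ → ℝ) : Prop where
  memC1 : memC1 α f
  mInt_eq : mInt f = 1
  le : ∀ x ∈ Ioc (0:ℝ) 1, f x ≤ a * x^(-α)

lemma integrableOn_rpow_bound {α : ℝ} (a : ℝ) (hα1 : α < 1) :
    IntegrableOn (fun x : ℝ => a * x^(-α)) (Ioc 0 1) := by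
  have := intervalIntegral.intervalIntegrable_rpow' (a := 0) (b := 1) (by linarith : -1 < -α)
  exact ((intervalIntegrable_iff_integrableOn_Ioc_of_le zero_le_one).1 this).const_mul a

lemma IsConeDensity.norm_le {α a : ℝ} {f : ℝ → ℝ} (hf : IsConeDensity α a f) :
    ∀ x ∈ Ioc (0:ℝ) 1, ‖f x‖ ≤ a * x^(-α) := fun x hx => by
  rw [Real.norm_of_nonneg (hf.memC1.2.1 x hx)]
  exact hf.le x hx

lemma IsConeDensity.integrableOn {α a : ℝ} {f : ℝ → ℝ} (hα1 : α < 1)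
    (hf : IsConeDensity α a f) : IntegrableOn f (Ioc 0 1) :=
  (integrableOn_rpow_bound a hα1).mono' hf.memC1.aestronglyMeasurable
    ((ae_restrict_iff' measurableSet_Ioc).2 (ae_of_all _ hf.norm_le))

lemma mInt_eq_toReal_lintegral {α : ℝ} {f : ℝ → ℝ} (hf : memC1 α f) :
    mInt f = (∫⁻ x in Ioc 0 1, ENNReal.ofReal (f x)).toReal :=
  integral_eq_lintegral_of_nonneg_ae
    ((ae_restrict_iff' measurableSet_Ioc).2 (ae_of_all _ hf.2.1)) hf.aestronglyMeasurable

lemma mInt_Pop {α : ℝ} {f : ℝ → ℝ} (hα0 : 0 < α) (hf : memC1 α f) :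
    mInt (Pop α f) = mInt f := by
  have h := setLIntegral_Pop hα0 hf MeasurableSet.univ
  rw [preimage_univ, univ_inter] at h
  rw [mInt_eq_toReal_lintegral hf, mInt_eq_toReal_lintegral (hf.map_Pop hα0), h]

lemma IsConeDensity.apply_two_thirds_le {α a : ℝ} {f : ℝ → ℝ} (hα1 : α < 1)
    (hf : IsConeDensity α a f) : f (2/3) ≤ 3/2 := by
  have hi := hf.integrableOn hα1
  have hsub : Ioc (0:ℝ) (2/3) ⊆ Ioc 0 1 := Ioc_subset_Ioc_right (by norm_num)
  have h1 : ∫ x in Ioc (0:ℝ) (2/3), f x ≤ mInt f :=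
    setIntegral_mono_set hi ((ae_restrict_iff' measurableSet_Ioc).2
      (ae_of_all _ hf.memC1.2.1)) hsub.eventuallyLE
  have h2 : ∫ _ in Ioc (0:ℝ) (2/3), f (2/3) ≤ ∫ x in Ioc (0:ℝ) (2/3), f x :=
    setIntegral_mono_on (integrableOn_const (by simp)) (hi.mono_set hsub) measurableSet_Ioc
      fun x hx => hf.memC1.2.2.1 (hsub hx) (by norm_num) hx.2
  rw [hf.mInt_eq] at h1
  simp only [setIntegral_const, measureReal_def, Real.volume_Ioc, smul_eq_mul] at h2
  rw [ENNReal.toReal_ofReal (by norm_num)] at h2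
  linarith

lemma IsConeDensity.map_Pop {α a : ℝ} {f : ℝ → ℝ} (hα0 : 0 < α) (hα1 : α < 1) (ha : 2 + α ≤ a)
    (hf : IsConeDensity α a f) : IsConeDensity α a (Pop α f) := by
  refine ⟨hf.memC1.map_Pop hα0, (mInt_Pop hα0 hf.memC1).trans hf.mInt_eq, fun x hx => ?_⟩
  have hright : rightOp f x ≤ 1/2 := by
    have hz := right_preimage_mem hx
    have h1 := hf.memC1.2.2.1 (by norm_num : (2/3:ℝ) ∈ Ioc (0:ℝ) 1) (Ioc_two_thirds_subset hz)
      hz.1.le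
    have h2 := hf.apply_two_thirds_le hα1
    rw [rightOp]
    linarith
  obtain ⟨y, hy, rfl⟩ := exists_Tmap_left_eq hα0 hx
  have hy1 : y ∈ Ioc (0:ℝ) 1 := ⟨hy.1, hy.2.trans (by norm_num)⟩
  have hc := half_le_leftCoeff hα0
  have hY : 0 < y^α := Real.rpow_pos_of_pos hy.1 _
  have hs : leftCoeff α * y^α ≤ 1/2 := leftCoeff_mul_rpow_le hα0 hy.1.le hy.2
  have hs0 : 0 < leftCoeff α * y^α := mul_pos (by linarith) hY
  have hfy := hf.le y hy1
  rw [Real.rpow_neg hy.1.le] at hfy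
  rw [Pop_eq_add, leftOp_Tmap hα0 f hy, Tderiv_left hy.2]
  rw [Tmap_left hα0 hy.1.le hy.2] at hright ⊢
  rw [Real.rpow_neg (mul_nonneg hy.1.le (by linarith)), Real.mul_rpow hy.1.le (by linarith)]
  generalize hsdef : leftCoeff α * y^α = s at *
  have hD : 0 < 1 + (1+α)*s := by positivity
  have hE : 0 < 1 + α*s := by positivity
  have hb : (1+s)^α ≤ 1 + α*s := rpow_one_add_le_one_add_mul_self (by linarith) hα0.le hα1.le
  have h1 : f y / (1+(1+α)*s) ≤ a * (y^α)⁻¹ / (1+(1+α)*s) := by gcongr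
  have h2 : a * (y^α * (1+α*s))⁻¹ ≤ a * (y^α * (1+s)^α)⁻¹ := by
    have : 0 < (1+s)^α := by positivity
    have : 0 ≤ a := by linarith
    gcongr
  have h3 : a * (y^α)⁻¹ / (1+(1+α)*s) + 1/2 ≤ a * (y^α * (1+α*s))⁻¹ := by
    have he : a * (y^α * (1+α*s))⁻¹ - a * (y^α)⁻¹ / (1+(1+α)*s)
        = a * leftCoeff α / ((1+α*s) * (1+(1+α)*s)) := by
      have hsy : s / y^α = leftCoeff α := by rw [← hsdef]; field_simp
      rw [← hsy]
      field_simp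
      ring
    have hprod : (1+α*s) * (1+(1+α)*s) ≤ 2 + α := by
      have : (1+α*s) * (1+(1+α)*s) ≤ (1+α*(1/2)) * (1+(1+α)*(1/2)) := by gcongr
      nlinarith
    have : 1/2 ≤ a * leftCoeff α / ((1+α*s) * (1+(1+α)*s)) := by
      rw [le_div_iff₀ (by positivity)]
      nlinarith
    linarith
  linarith

lemma isConeDensity_one {α a : ℝ} (hα0 : 0 < α) (ha : 1 ≤ a) :
    IsConeDensity α a (fun _ => 1) := by
  refine ⟨memC1_one hα0, by simp [mInt], fun x hx => ?_⟩
  have := Real.one_le_rpow_of_pos_of_le_one_of_nonpos hx.1 hx.2 (by linarith : -α ≤ 0)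
  nlinarith

lemma memC1_sum {α : ℝ} (hα0 : 0 < α) {f : ℕ → ℝ → ℝ} (hf : ∀ n, memC1 α (f n)) (n : ℕ) :
    memC1 α (fun x => ∑ k ∈ Finset.range n, f k x) := by
  induction n with
  | zero => simpa using (memC1_one hα0).const_mul le_rfl
  | succ n ih => simpa only [Finset.sum_range_succ] using ih.add (hf n)

lemma isConeDensity_average {α a : ℝ} (hα0 : 0 < α) (hα1 : α < 1) {f : ℕ → ℝ → ℝ}
    (hf : ∀ n, IsConeDensity α a (f n)) (n : ℕ) :
    IsConeDensity α a (fun x => ((n:ℝ)+1)⁻¹ * ∑ k ∈ Finset.range (n+1), f k x) := by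
  have hn : (0:ℝ) < n + 1 := by positivity
  refine ⟨(memC1_sum hα0 (fun k => (hf k).memC1) _).const_mul (inv_nonneg.2 hn.le), ?_,
    fun x hx => ?_⟩
  · have hm : ∀ k, ∫ x in Ioc (0:ℝ) 1, f k x = 1 := fun k => (hf k).mInt_eq
    rw [mInt, integral_const_mul, integral_finsetSum _ fun k _ => (hf k).integrableOn hα1]
    simp [hm, hn.ne']
  · have h := Finset.sum_le_sum fun k (_ : k ∈ Finset.range (n+1)) => (hf k).le x hx
    rw [Finset.sum_const, Finset.card_range, nsmul_eq_mul, Nat.cast_succ] at h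
    rw [inv_mul_le_iff₀ hn]
    exact h

lemma Pop_average (α : ℝ) (f : ℕ → ℝ → ℝ) (hf : ∀ n, f (n+1) = Pop α (f n)) (n : ℕ) (x : ℝ) :
    Pop α (fun x => ((n:ℝ)+1)⁻¹ * ∑ k ∈ Finset.range (n+1), f k x) x
      = ((n:ℝ)+1)⁻¹ * ∑ k ∈ Finset.range (n+1), f k x
        + ((n:ℝ)+1)⁻¹ * (f (n+1) x - f 0 x) := by
  have h : ∀ k, f k (leftInv α x) / Tderiv α (leftInv α x) + f k ((x+2)/3) / 3 = f (k+1) x :=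
    fun k => by rw [hf]; rfl
  have hsum : ∑ k ∈ Finset.range (n+1), f (k+1) x
      = ∑ k ∈ Finset.range (n+1), f k x + (f (n+1) x - f 0 x) := by
    have h1 := Finset.sum_range_succ (fun k => f k x) (n+1)
    have h2 := Finset.sum_range_succ' (fun k => f k x) (n+1)
    linarith
  rw [← mul_add, ← hsum]
  simp only [← h, Finset.sum_add_distrib, ← Finset.sum_div, Pop]
  ring

lemma exists_subseq_tendsto {α a : ℝ} (hα0 : 0 < α) {g : ℕ → ℝ → ℝ}
    (hg : ∀ n, IsConeDensity α a (g n)) :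
    ∃ (h : ℝ → ℝ) (φ : ℕ → ℕ), StrictMono φ ∧
      ∀ x ∈ Ioc (0:ℝ) 1, Tendsto (fun n => g (φ n) x) atTop (𝓝 (h x)) := by
  let u : ℕ → ℚ → ℝ := fun n q => if (q:ℝ) ∈ Ioc (0:ℝ) 1 then g n q else 0
  have hu : ∀ n, u n ∈ Set.pi univ
      fun q : ℚ => if (q:ℝ) ∈ Ioc (0:ℝ) 1 then Icc 0 (a * (q:ℝ)^(-α)) else {0} := by
    intro n q _
    by_cases hq : (q:ℝ) ∈ Ioc (0:ℝ) 1
    · simp only [u, if_pos hq]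
      exact ⟨(hg n).memC1.2.1 _ hq, (hg n).le _ hq⟩
    · simp only [u, if_neg hq, mem_singleton_iff]
  have hK : IsCompact (Set.pi univ
      fun q : ℚ => if (q:ℝ) ∈ Ioc (0:ℝ) 1 then Icc 0 (a * (q:ℝ)^(-α)) else {0}) := by
    refine isCompact_univ_pi fun q => ?_
    split_ifs
    exacts [isCompact_Icc, isCompact_singleton]
  obtain ⟨l, -, φ, hφ, hl⟩ := hK.tendsto_subseq hu
  have hrat : ∀ q : ℚ, (q:ℝ) ∈ Ioc (0:ℝ) 1 → CauchySeq fun n => g (φ n) q := by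
    intro q hq
    have := (tendsto_pi_nhds.1 hl q).cauchySeq
    simpa only [u, Function.comp_apply, if_pos hq] using this
  have hcau : ∀ x ∈ Ioc (0:ℝ) 1, CauchySeq fun n => g (φ n) x := by
    intro x hx
    rw [Metric.cauchySeq_iff]
    intro ε hε
    have hcont : ContinuousAt (fun p : ℝ => (1 - (p/x)^(α+1)) * (a * p^(-α))) x := by
      refine ContinuousAt.mul (continuousAt_const.sub ?_)
        (continuousAt_const.mul (Real.continuousAt_rpow_const _ _ (Or.inl hx.1.ne')))
      exact (continuousAt_id.div_const x).rpow_const (Or.inl (div_pos hx.1 hx.1).ne')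
    have hev : ∀ᶠ p in 𝓝 x, (1 - (p/x)^(α+1)) * (a * p^(-α)) < ε/3 := by
      refine hcont.eventually_lt_const ?_
      simpa [div_self hx.1.ne'] using hε
    obtain ⟨δ, hδ, hball⟩ := Metric.eventually_nhds_iff.1 hev
    obtain ⟨q, hq1, hq2⟩ := exists_rat_btwn (max_lt (by linarith : x - δ < x) hx.1)
    have hqδ := (max_lt_iff.1 hq1).1
    have hqI : (q:ℝ) ∈ Ioc (0:ℝ) 1 := ⟨(max_lt_iff.1 hq1).2, hq2.le.trans hx.2⟩
    have hsmall := hball (y := (q:ℝ)) (by rw [Real.dist_eq, abs_lt]; constructor <;> linarith)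
    have hclose : ∀ n, g n x ≤ g n q ∧ g n q - g n x < ε/3 := by
      intro n
      refine ⟨(hg n).memC1.2.2.1 hqI hx hq2.le, ?_⟩
      have h1 := (hg n).memC1.rpow_div_mul_le hqI hx hq2.le
      have h2 : (q/x:ℝ)^(α+1) ≤ 1 :=
        Real.rpow_le_one (div_pos hqI.1 hx.1).le ((div_le_one hx.1).2 hq2.le) (by linarith)
      have h3 := mul_le_mul_of_nonneg_left ((hg n).le _ hqI) (sub_nonneg.2 h2)
      linarith
    obtain ⟨N, hN⟩ := Metric.cauchySeq_iff.1 (hrat q hqI) (ε/3) (by linarith)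
    refine ⟨N, fun m hm n hn => ?_⟩
    have h := hN m hm n hn
    rw [Real.dist_eq, abs_lt] at h ⊢
    have h1 := hclose (φ m)
    have h2 := hclose (φ n)
    constructor <;> linarith
  choose! h hh using fun x hx => cauchySeq_tendsto_of_complete (hcau x hx)
  exact ⟨h, φ, hφ, hh⟩

lemma IsConeDensity.of_tendsto {α a : ℝ} (hα1 : α < 1) {g : ℕ → ℝ → ℝ} {h : ℝ → ℝ}
    (hg : ∀ n, IsConeDensity α a (g n))
    (hlim : ∀ x ∈ Ioc (0:ℝ) 1, Tendsto (fun n => g n x) atTop (𝓝 (h x))) :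
    IsConeDensity α a h := by
  have hC1 : _root_.memC1 α h := by
    refine memC1_of_monotone (fun x hx => ?_) (fun x hx y hy hxy => ?_) (fun x hx y hy hxy => ?_)
    · exact ge_of_tendsto' (hlim x hx) fun n => (hg n).memC1.2.1 x hx
    · exact le_of_tendsto_of_tendsto' (hlim y hy) (hlim x hx) fun n =>
        (hg n).memC1.2.2.1 hx hy hxy
    · exact le_of_tendsto_of_tendsto' ((hlim x hx).const_mul _) ((hlim y hy).const_mul _)
        fun n => (hg n).memC1.2.2.2 hx hy hxy
  refine ⟨hC1, ?_, fun x hx => le_of_tendsto' (hlim x hx) fun n => (hg n).le x hx⟩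
  have hI := tendsto_integral_of_dominated_convergence (μ := volume.restrict (Ioc (0:ℝ) 1))
    (F := g) (f := h) (fun x => a * x^(-α)) (fun n => (hg n).memC1.aestronglyMeasurable)
    (integrableOn_rpow_bound a hα1)
    (fun n => (ae_restrict_iff' measurableSet_Ioc).2 (ae_of_all _ (hg n).norm_le))
    ((ae_restrict_iff' measurableSet_Ioc).2 (ae_of_all _ hlim))
  refine tendsto_nhds_unique hI ?_
  have : ∀ n, ∫ x in Ioc (0:ℝ) 1, g n x = 1 := fun n => (hg n).mInt_eq
  simp only [this, tendsto_const_nhds]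

lemma leftInv_mem_Ioc {α x : ℝ} (hα0 : 0 < α) (hx : x ∈ Ioc (0:ℝ) 1) :
    leftInv α x ∈ Ioc (0:ℝ) 1 := by
  obtain ⟨y, hy, rfl⟩ := exists_Tmap_left_eq hα0 hx
  rw [leftInv_Tmap hα0 (Ioc_subset_Icc_self hy)]
  exact ⟨hy.1, hy.2.trans (by norm_num)⟩

/-- The transfer operator has a fixed point among the normalized functions of the cone. -/
theorem exists_isConeDensity_Pop_eq {α a : ℝ} (hα0 : 0 < α) (hα1 : α < 1) (ha : 2 + α ≤ a) :
    ∃ h : ℝ → ℝ, IsConeDensity α a h ∧ ∀ x ∈ Ioc (0:ℝ) 1, Pop α h x = h x := by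
  let f : ℕ → ℝ → ℝ := fun n => (Pop α)^[n] fun _ => 1
  have hfs : ∀ n, f (n+1) = Pop α (f n) := fun n => Function.iterate_succ_apply' _ _ _
  have hf : ∀ n, IsConeDensity α a (f n) := by
    intro n
    induction n with
    | zero => exact isConeDensity_one hα0 (by linarith)
    | succ n ih => rw [hfs]; exact ih.map_Pop hα0 hα1 ha
  let g : ℕ → ℝ → ℝ := fun n x => ((n:ℝ)+1)⁻¹ * ∑ k ∈ Finset.range (n+1), f k x
  have hg : ∀ n, IsConeDensity α a (g n) := isConeDensity_average hα0 hα1 hf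
  obtain ⟨h, φ, hφ, hlim⟩ := exists_subseq_tendsto hα0 hg
  refine ⟨h, IsConeDensity.of_tendsto hα1 (fun n => hg (φ n)) hlim, fun x hx => ?_⟩
  have h1 : Tendsto (fun n => Pop α (g (φ n)) x) atTop (𝓝 (Pop α h x)) :=
    ((hlim _ (leftInv_mem_Ioc hα0 hx)).div_const _).add
      ((hlim _ (Ioc_two_thirds_subset (right_preimage_mem hx))).div_const _)
  have herr : Tendsto (fun n : ℕ => ((n:ℝ)+1)⁻¹ * (f (n+1) x - f 0 x)) atTop (𝓝 0) := by
    have hz : Tendsto (fun n : ℕ => ((n:ℝ)+1)⁻¹) atTop (𝓝 0) := by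
      simpa using tendsto_one_div_add_atTop_nhds_zero_nat (𝕜 := ℝ)
    refine hz.zero_mul_isBoundedUnder_le (isBoundedUnder_of ⟨a * x^(-α), fun n => ?_⟩)
    have e1 := (hf (n+1)).memC1.2.1 x hx
    have e2 := (hf (n+1)).le x hx
    have e3 := (hf 0).memC1.2.1 x hx
    have e4 := (hf 0).le x hx
    simp only [Function.comp_apply, Real.norm_eq_abs]
    exact abs_le.2 ⟨by linarith, by linarith⟩
  have h2 : Tendsto (fun n => Pop α (g (φ n)) x) atTop (𝓝 (h x + 0)) := by
    refine ((hlim x hx).add (herr.comp hφ.tendsto_atTop)).congr fun n => ?_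
    exact (Pop_average α f hfs (φ n) x).symm
  rw [add_zero] at h2
  exact tendsto_nhds_unique h1 h2

/-- On `J`, the set `A` has relative mass at least `κ` with respect to every density of the
cone `C₁`. -/
def RelMassGE (α : ℝ) (A : Set ℝ) (κ : ENNReal) (J : Set ℝ) : Prop :=
  ∀ g : ℝ → ℝ, memC1 α g →
    κ * ∫⁻ x in J, ENNReal.ofReal (g x) ≤ ∫⁻ x in A ∩ J, ENNReal.ofReal (g x)

lemma RelMassGE.left {α : ℝ} {A J : Set ℝ} {κ : ENNReal} (hα0 : 0 < α) (hA : MeasurableSet A)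
    (hinv : Tmap α ⁻¹' A = A) (hJ : MeasurableSet J) (hJ1 : J ⊆ Ioc 0 1)
    (h : RelMassGE α A κ J) : RelMassGE α A κ (Tmap α ⁻¹' J ∩ Ioc 0 (2/3)) := by
  intro g hg
  have h1 := h _ (hg.map_leftOp hα0)
  have e1 := setLIntegral_leftOp hα0 g hJ
  have e2 := setLIntegral_leftOp hα0 g (hA.inter hJ)
  rw [inter_eq_left.2 hJ1] at e1
  rw [inter_eq_left.2 (inter_subset_right.trans hJ1), preimage_inter, hinv, inter_assoc] at e2
  rwa [e1, e2] at h1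

lemma RelMassGE.right {α : ℝ} {A J : Set ℝ} {κ : ENNReal} (hα0 : 0 < α) (hA : MeasurableSet A)
    (hinv : Tmap α ⁻¹' A = A) (hJ : MeasurableSet J) (hJ1 : J ⊆ Ioc 0 1)
    (h : RelMassGE α A κ J) : RelMassGE α A κ (Tmap α ⁻¹' J ∩ Ioc (2/3) 1) := by
  intro g hg
  have h1 := h _ (hg.map_rightOp hα0)
  have e1 := setLIntegral_rightOp α g hJ
  have e2 := setLIntegral_rightOp α g (hA.inter hJ)
  rw [inter_eq_left.2 hJ1] at e1
  rw [inter_eq_left.2 (inter_subset_right.trans hJ1), preimage_inter, hinv, inter_assoc] at e2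
  rwa [e1, e2] at h1

lemma RelMassGE.base {α : ℝ} {A : Set ℝ} (hα0 : 0 < α) (hα1 : α < 1) (hA : MeasurableSet A)
    (hinv : Tmap α ⁻¹' A = A) :
    RelMassGE α A (ENNReal.ofReal (4/9) * volume (A ∩ Ioc 0 1)) (Ioc (2/3) 1) := by
  intro g hg
  have hone : (1:ℝ) ∈ Ioc (0:ℝ) 1 := by norm_num
  have hmass : volume (A ∩ Ioc (2/3) 1) = ENNReal.ofReal (1/3) * volume (A ∩ Ioc (0:ℝ) 1) := by
    have h := setLIntegral_rightOp α (fun _ => 1) hA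
    rw [hinv] at h
    simpa [rightOp] using h.symm
  have hup : ∫⁻ x in Ioc (2/3:ℝ) 1, ENNReal.ofReal (g x)
      ≤ ENNReal.ofReal (9/4 * g 1) * ENNReal.ofReal (1/3) := by
    calc ∫⁻ x in Ioc (2/3:ℝ) 1, ENNReal.ofReal (g x)
        ≤ ∫⁻ _ in Ioc (2/3:ℝ) 1, ENNReal.ofReal (9/4 * g 1) := by
          refine setLIntegral_mono' measurableSet_Ioc fun x hx => ENNReal.ofReal_le_ofReal ?_
          have h1 := hg.rpow_div_mul_le (Ioc_two_thirds_subset hx) hone hx.2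
          have h2 : (x/1)^(2:ℝ) ≤ (x/1)^(α+1) :=
            Real.rpow_le_rpow_of_exponent_ge (by linarith [hx.1]) (by linarith [hx.2])
              (by linarith)
          rw [Real.rpow_two, div_one] at h2
          rw [div_one] at h1
          have h3 : 4/9 ≤ x^2 := by nlinarith [hx.1]
          have h4 := hg.2.1 x (Ioc_two_thirds_subset hx)
          nlinarith
      _ = _ := by
          rw [setLIntegral_const, Real.volume_Ioc]
          norm_num
  have hlow : ENNReal.ofReal (g 1) * (ENNReal.ofReal (1/3) * volume (A ∩ Ioc (0:ℝ) 1))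
      ≤ ∫⁻ x in A ∩ Ioc (2/3) 1, ENNReal.ofReal (g x) := by
    rw [← hmass, ← setLIntegral_const]
    refine setLIntegral_mono' (hA.inter measurableSet_Ioc) fun x hx => ENNReal.ofReal_le_ofReal ?_
    exact hg.2.2.1 (Ioc_two_thirds_subset hx.2) hone hx.2.2
  refine (mul_le_mul_right hup _).trans (le_trans (le_of_eq ?_) hlow)
  have : ENNReal.ofReal (4/9) * ENNReal.ofReal (9/4 * g 1) = ENNReal.ofReal (g 1) := by
    rw [← ENNReal.ofReal_mul (by norm_num)]
    congr 1
    ring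
  rw [← this]
  ring

/-- The point `x` lies in an interval of length at most `ℓ` on which `A` has large relative
mass. -/
def HasGoodInterval (α : ℝ) (A : Set ℝ) (κ : ENNReal) (ℓ x : ℝ) : Prop :=
  ∃ p q : ℝ, 0 ≤ p ∧ q ≤ 1 ∧ x ∈ Ioc p q ∧ q - p ≤ ℓ ∧ RelMassGE α A κ (Ioc p q)

lemma HasGoodInterval.left {α : ℝ} {A : Set ℝ} {κ : ENNReal} {ℓ x : ℝ} (hα0 : 0 < α)
    (hA : MeasurableSet A) (hinv : Tmap α ⁻¹' A = A) (hx : x ∈ Ioc (0:ℝ) (2/3))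
    (h : HasGoodInterval α A κ ℓ (Tmap α x)) : HasGoodInterval α A κ ℓ x := by
  obtain ⟨p, q, hp, hq, hxJ, hlen, hJ⟩ := h
  have hpq : p < q := hxJ.1.trans_le hxJ.2
  obtain ⟨p', hp', rfl⟩ := exists_Tmap_left_eq_of_mem_Icc hα0 ⟨hp, by linarith⟩
  obtain ⟨q', hq', rfl⟩ := exists_Tmap_left_eq_of_mem_Icc hα0 ⟨by linarith, hq⟩
  have hmono := strictMonoOn_Tmap_left hα0
  have hpq' : p' < q' := (hmono.lt_iff_lt hp' hq').1 hpq
  have hset : Tmap α ⁻¹' Ioc (Tmap α p') (Tmap α q') ∩ Ioc 0 (2/3) = Ioc p' q' := by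
    ext y
    constructor
    · rintro ⟨hy, hy'⟩
      have hy2 := Ioc_subset_Icc_self hy'
      exact ⟨(hmono.lt_iff_lt hp' hy2).1 hy.1, (hmono.le_iff_le hy2 hq').1 hy.2⟩
    · intro hy
      have hy' : y ∈ Ioc (0:ℝ) (2/3) := ⟨hp'.1.trans_lt hy.1, hy.2.trans hq'.2⟩
      have hy2 := Ioc_subset_Icc_self hy'
      exact ⟨⟨(hmono.lt_iff_lt hp' hy2).2 hy.1, (hmono.le_iff_le hy2 hq').2 hy.2⟩, hy'⟩
  have hlen' := sub_le_Tmap_sub hα0 hp'.1 hpq'.le hq'.2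
  refine ⟨p', q', hp'.1, hq'.2.trans (by norm_num), ?_, by linarith, ?_⟩
  · rw [← hset]
    exact ⟨hxJ, hx⟩
  · rw [← hset]
    exact hJ.left hα0 hA hinv measurableSet_Ioc (Ioc_subset_Ioc hp hq)

lemma HasGoodInterval.right {α : ℝ} {A : Set ℝ} {κ : ENNReal} {ℓ x : ℝ} (hα0 : 0 < α)
    (hA : MeasurableSet A) (hinv : Tmap α ⁻¹' A = A) (hx : x ∈ Ioc (2/3:ℝ) 1)
    (h : HasGoodInterval α A κ ℓ (Tmap α x)) : HasGoodInterval α A κ (ℓ/3) x := by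
  obtain ⟨p, q, hp, hq, hxJ, hlen, hJ⟩ := h
  have hset : Tmap α ⁻¹' Ioc p q ∩ Ioc (2/3) 1 = Ioc ((p+2)/3) ((q+2)/3) := by
    ext y
    constructor
    · rintro ⟨hy, hy'⟩
      rw [mem_preimage, Tmap_right hy'.1] at hy
      constructor <;> linarith [hy.1, hy.2]
    · intro hy
      have hy' : y ∈ Ioc (2/3:ℝ) 1 := by constructor <;> linarith [hy.1, hy.2]
      refine ⟨?_, hy'⟩
      rw [mem_preimage, Tmap_right hy'.1]
      constructor <;> linarith [hy.1, hy.2]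
  refine ⟨(p+2)/3, (q+2)/3, by linarith, by linarith, ?_, by linarith, ?_⟩
  · rw [← hset]
    exact ⟨hxJ, hx⟩
  · rw [← hset]
    exact hJ.right hα0 hA hinv measurableSet_Ioc (Ioc_subset_Ioc hp hq)

/-- Under iteration of the left branch every point of `(0, 1]` reaches the right branch, so a
property that holds on `(2/3, 1]` and is inherited along the left branch holds on `(0, 1]`. -/
lemma of_right_of_left {α : ℝ} (hα0 : 0 < α) {Q : ℝ → Prop}
    (hright : ∀ x ∈ Ioc (2/3:ℝ) 1, Q x) (hleft : ∀ x ∈ Ioc (0:ℝ) (2/3), Q (Tmap α x) → Q x) :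
    ∀ x ∈ Ioc (0:ℝ) 1, Q x := by
  have key : ∀ η : ℝ, 0 < η → ∀ n : ℕ, ∀ x ∈ Ioc (0:ℝ) 1,
      η ≤ x → 1 ≤ x + n * (leftCoeff α * (η * η^α)) → Q x := by
    intro η hη n
    have hc := leftCoeff_pos α
    have hstep : 0 < leftCoeff α * (η * η^α) := by positivity
    induction n with
    | zero =>
      intro x hx _ h
      simp only [Nat.cast_zero, zero_mul, add_zero] at h
      exact hright x ⟨by linarith, hx.2⟩
    | succ n ih =>
      intro x hx hηx h
      rcases lt_or_ge (2/3) x with h2 | h2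
      · exact hright x ⟨h2, hx.2⟩
      · have hx' : x ∈ Ioc (0:ℝ) (2/3) := ⟨hx.1, h2⟩
        have hm : η * η^α ≤ x * x^α :=
          mul_le_mul hηx (Real.rpow_le_rpow hη.le hηx hα0.le) (by positivity) hx.1.le
        have hT : Tmap α x = x + leftCoeff α * (x * x^α) := by
          rw [Tmap_left hα0 hx.1.le h2]; ring
        have hge : x + leftCoeff α * (η * η^α) ≤ Tmap α x := by rw [hT]; gcongr
        refine hleft x hx' (ih _ (Tmap_left_mem_Ioc hα0 hx') (by linarith) ?_)
        push_cast at h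
        linarith
  intro x hx
  have hstep : 0 < leftCoeff α * (x * x^α) :=
    mul_pos (leftCoeff_pos α) (mul_pos hx.1 (Real.rpow_pos_of_pos hx.1 _))
  obtain ⟨n, hn⟩ := exists_nat_ge (1 / (leftCoeff α * (x * x^α)))
  rw [div_le_iff₀ hstep] at hn
  exact key x hx.1 n x hx le_rfl (by linarith [hx.1])

lemma hasGoodInterval_pow {α : ℝ} {A : Set ℝ} (hα0 : 0 < α) (hα1 : α < 1) (hA : MeasurableSet A)
    (hinv : Tmap α ⁻¹' A = A) (n : ℕ) : ∀ x ∈ Ioc (0:ℝ) 1,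
      HasGoodInterval α A (ENNReal.ofReal (4/9) * volume (A ∩ Ioc 0 1)) ((1/3)^n) x := by
  induction n with
  | zero =>
    refine of_right_of_left hα0 (fun x hx => ?_) fun x hx h => h.left hα0 hA hinv hx
    exact ⟨2/3, 1, by norm_num, le_rfl, hx, by norm_num, RelMassGE.base hα0 hα1 hA hinv⟩
  | succ n ih =>
    refine of_right_of_left hα0 (fun x hx => ?_) fun x hx h => h.left hα0 hA hinv hx
    have := (ih _ (Tmap_right_mem_Ioc hx)).right hα0 hA hinv hx
    rwa [pow_succ, ← div_eq_mul_one_div]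

/-- An invariant set of positive measure has full measure in `(0, 1]`. -/
theorem volume_diff_eq_zero_of_invariant {α : ℝ} {A : Set ℝ} (hα0 : 0 < α) (hα1 : α < 1)
    (hA : MeasurableSet A) (hinv : Tmap α ⁻¹' A = A) (hpos : volume (A ∩ Ioc 0 1) ≠ 0) :
    volume (Ioc 0 1 \ A) = 0 := by
  by_contra hne
  set κ := ENNReal.ofReal (4/9) * volume (A ∩ Ioc 0 1)
  have hκ0 : κ ≠ 0 := mul_ne_zero (by simp) hpos
  have hdens := IsUnifLocDoublingMeasure.ae_tendsto_measure_inter_div (volume : Measure ℝ)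
    (Ioc 0 1 \ A) 1
  rw [ae_restrict_iff' (measurableSet_Ioc.diff hA)] at hdens
  refine hne (measure_mono_null ?_ (ae_iff.1 hdens))
  intro x hxS hx
  choose p q hp hq hxJ hlen hJ using fun n => hasGoodInterval_pow hα0 hα1 hA hinv n x hxS.1
  have hpq : ∀ n, p n < q n := fun n => (hxJ n).1.trans_le (hxJ n).2
  have hball : ∀ n, Metric.closedBall ((p n + q n)/2) ((q n - p n)/2) = Icc (p n) (q n) :=
    fun n => by rw [Real.closedBall_eq_Icc]; congr 1 <;> ring
  have hδ : Tendsto (fun n => (q n - p n)/2) atTop (𝓝[>] 0) := by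
    refine tendsto_nhdsWithin_iff.2 ⟨?_, Eventually.of_forall fun n => ?_⟩
    · refine squeeze_zero (fun n => by linarith [hpq n]) (fun n => ?_)
        (tendsto_pow_atTop_nhds_zero_of_lt_one (by norm_num) (by norm_num : (1/3:ℝ) < 1))
      linarith [hpq n, hlen n]
    · exact half_pos (sub_pos.2 (hpq n))
  have hlim := hx hxS (fun n => (p n + q n)/2) (fun n => (q n - p n)/2) hδ
    (Eventually.of_forall fun n => by rw [one_mul, hball]; exact Ioc_subset_Icc_self (hxJ n))
  simp only [hball] at hlim
  have hbound : ∀ n, volume ((Ioc 0 1 \ A) ∩ Icc (p n) (q n)) / volume (Icc (p n) (q n)) + κ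
      ≤ 1 := by
    intro n
    have hV0 : volume (Icc (p n) (q n)) ≠ 0 := by
      simpa [Real.volume_Icc] using hpq n
    have hVt : volume (Icc (p n) (q n)) ≠ ⊤ := by simp [Real.volume_Icc]
    have h1 : κ * volume (Icc (p n) (q n)) ≤ volume (A ∩ Ioc (p n) (q n)) := by
      have := hJ n _ (memC1_one hα0)
      simpa [Real.volume_Icc, Real.volume_Ioc] using this
    have h2 : volume ((Ioc 0 1 \ A) ∩ Icc (p n) (q n)) + volume (A ∩ Ioc (p n) (q n))
        ≤ volume (Icc (p n) (q n)) := by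
      rw [← measure_union _ (hA.inter measurableSet_Ioc)]
      · exact measure_mono (union_subset inter_subset_right
          (inter_subset_right.trans Ioc_subset_Icc_self))
      · exact disjoint_sdiff_left.mono inter_subset_left inter_subset_left
    rw [← ENNReal.mul_div_cancel_right (a := κ) hV0 hVt, ← ENNReal.add_div]
    exact ENNReal.div_le_of_le_mul (by rw [one_mul]; exact (add_le_add_right h1 _).trans h2)
  have h1 : 1 + κ ≤ 1 := le_of_tendsto' (hlim.add_const κ) hbound
  have h2 : (1:ENNReal) < 1 + κ := ENNReal.lt_add_right (by simp) hκ0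
  exact absurd h1 h2.not_ge

lemma IsConeDensity.pos {α a : ℝ} {h : ℝ → ℝ} (hh : IsConeDensity α a h) :
    ∀ x ∈ Ioc (0:ℝ) 1, 0 < h x := by
  intro x hx
  refine (hh.memC1.2.1 x hx).lt_of_ne' fun h0 => ?_
  have hzero : ∀ y ∈ Ioc (0:ℝ) 1, h y = 0 := by
    intro y hy
    refine le_antisymm ?_ (hh.memC1.2.1 y hy)
    rcases le_total x y with hxy | hxy
    · exact (hh.memC1.2.2.1 hx hy hxy).trans h0.le
    · have h1 := hh.memC1.rpow_div_mul_le hy hx hxy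
      rw [h0] at h1
      exact nonpos_of_mul_nonpos_right h1 (Real.rpow_pos_of_pos (div_pos hy.1 hx.1) _)
  have h1 := hh.mInt_eq
  rw [mInt, setIntegral_congr_fun measurableSet_Ioc hzero] at h1
  simp at h1

/-- The measure on `(0, 1]` with density `h`. -/
noncomputable def densityMeasure (h : ℝ → ℝ) : Measure ℝ :=
  (volume.restrict (Ioc (0:ℝ) 1)).withDensity (fun x => ENNReal.ofReal (h x))

lemma densityMeasure_apply (h : ℝ → ℝ) {B : Set ℝ} (hB : MeasurableSet B) :
    densityMeasure h B = ∫⁻ x in B ∩ Ioc 0 1, ENNReal.ofReal (h x) := by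
  rw [densityMeasure, withDensity_apply _ hB, Measure.restrict_restrict hB]

lemma map_Tmap_densityMeasure {α : ℝ} {h : ℝ → ℝ} (hα0 : 0 < α) (hh : memC1 α h)
    (hfix : ∀ x ∈ Ioc (0:ℝ) 1, Pop α h x = h x) :
    Measure.map (Tmap α) (densityMeasure h) = densityMeasure h := by
  ext B hB
  rw [Measure.map_apply (measurable_Tmap α) hB, densityMeasure_apply h (measurable_Tmap α hB),
    densityMeasure_apply h hB, ← setLIntegral_Pop hα0 hh hB]
  refine setLIntegral_congr_fun (hB.inter measurableSet_Ioc) fun x hx => ?_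
  rw [hfix x hx.2]

lemma IsConeDensity.isProbabilityMeasure {α a : ℝ} {h : ℝ → ℝ} (hh : IsConeDensity α a h) :
    IsProbabilityMeasure (densityMeasure h) := by
  constructor
  have h1 := mInt_eq_toReal_lintegral hh.memC1
  rw [densityMeasure_apply h MeasurableSet.univ, univ_inter]
  rw [hh.mInt_eq] at h1
  exact (ENNReal.toReal_eq_one_iff _).1 h1.symm

theorem ergodic_densityMeasure {α : ℝ} {h : ℝ → ℝ} (hα0 : 0 < α) (hα1 : α < 1)
    (hh : memC1 α h) (hfix : ∀ x ∈ Ioc (0:ℝ) 1, Pop α h x = h x) :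
    Ergodic (Tmap α) (densityMeasure h) where
  measurable := measurable_Tmap α
  map_eq := map_Tmap_densityMeasure hα0 hh hfix
  aeconst_set A hA hinv := by
    have hac : densityMeasure h ≪ volume.restrict (Ioc (0:ℝ) 1) :=
      withDensity_absolutelyContinuous _ _
    rw [eventuallyConst_set]
    by_cases hpos : volume (A ∩ Ioc (0:ℝ) 1) = 0
    · right
      refine ae_iff.2 (hac ?_)
      simpa [Measure.restrict_apply hA] using hpos
    · left
      refine ae_iff.2 (hac ?_)
      have := volume_diff_eq_zero_of_invariant hα0 hα1 hA hinv hpos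
      rwa [← compl_def, Measure.restrict_apply hA.compl, inter_comm, ← sdiff_eq]

lemma IsConeDensity.absolutelyContinuous {α a : ℝ} {h : ℝ → ℝ} (hh : IsConeDensity α a h)
    {μ : Measure ℝ} (hsupp : μ (Icc (0:ℝ) 1)ᶜ = 0) (hμ : μ ≪ volume) :
    μ ≪ densityMeasure h := by
  have h1 : μ ≪ volume.restrict (Ioc (0:ℝ) 1) := by
    refine Measure.AbsolutelyContinuous.mk fun s hs h0 => ?_
    rw [Measure.restrict_apply hs] at h0
    have hsub : s ⊆ s ∩ Ioc 0 1 ∪ {0} ∪ (Icc (0:ℝ) 1)ᶜ := by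
      intro x hx
      by_cases hI : x ∈ Icc (0:ℝ) 1
      · rcases hI.1.eq_or_lt with h | h
        · exact Or.inl (Or.inr h.symm)
        · exact Or.inl (Or.inl ⟨hx, h, hI.2⟩)
      · exact Or.inr hI
    exact measure_mono_null hsub
      (measure_union_null (measure_union_null (hμ h0) (hμ Real.volume_singleton)) hsupp)
  refine h1.trans (withDensity_absolutelyContinuous'
    hh.memC1.aestronglyMeasurable.aemeasurable.ennreal_ofReal ?_)
  refine (ae_restrict_iff' measurableSet_Ioc).2 (ae_of_all _ fun x hx => ?_)
  exact (ENNReal.ofReal_pos.2 (hh.pos x hx)).ne'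

/-- `T_α` admits a unique absolutely continuous invariant probability
measure; its density `h` lies in the cone `C₂`, satisfies `P_α h = h`, `h ≥ 0`,
`∫₀¹ h dm = 1` and `h x ≤ a x^(-α)`. -/
theorem exists_unique_acim_density (α a : ℝ) (hα0 : 0 < α) (hα1 : α < 1)
    (ha : (2:ℝ)^α * (2+α) / (1-α) ≤ a) :
    ∃ h : ℝ → ℝ, memC2 α a h ∧ mInt h = 1 ∧
      (∀ x ∈ Set.Ioc (0:ℝ) 1, 0 ≤ h x) ∧
      (∀ x ∈ Set.Ioc (0:ℝ) 1, Pop α h x = h x) ∧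
      (∀ x ∈ Set.Ioc (0:ℝ) 1, h x ≤ a * x^(-α)) ∧
      Measure.map (Tmap α)
          ((volume.restrict (Set.Ioc (0:ℝ) 1)).withDensity (fun x => ENNReal.ofReal (h x)))
        = (volume.restrict (Set.Ioc (0:ℝ) 1)).withDensity (fun x => ENNReal.ofReal (h x)) ∧
      ∀ μ : Measure ℝ, IsProbabilityMeasure μ → μ (Set.Icc (0:ℝ) 1)ᶜ = 0 →
        Measure.map (Tmap α) μ = μ → μ ≪ volume →
        μ = (volume.restrict (Set.Ioc (0:ℝ) 1)).withDensity (fun x => ENNReal.ofReal (h x)) := by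
  have ha' : 2 + α ≤ a := by
    refine le_trans ?_ ha
    have h2 : (1:ℝ) ≤ 2^α := Real.one_le_rpow (by norm_num) hα0.le
    rw [le_div_iff₀ (by linarith)]
    nlinarith
  obtain ⟨h, hh, hfix⟩ := exists_isConeDensity_Pop_eq hα0 hα1 ha'
  refine ⟨h, ⟨hh.memC1, hh.integrableOn hα1, fun x hx => ?_⟩, hh.mInt_eq, hh.memC1.2.1, hfix,
    hh.le, map_Tmap_densityMeasure hα0 hh.memC1 hfix, fun μ hμ hsupp hinv hac => ?_⟩
  · rw [hh.mInt_eq, mul_one]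
    exact hh.le x hx
  · have := hh.isProbabilityMeasure
    exact (ergodic_densityMeasure hα0 hα1 hh.memC1 hfix).eq_of_absolutelyContinuous
      ⟨measurable_Tmap α, hinv⟩ (hh.absolutelyContinuous hsupp hac)
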